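/- Let α be the unique zero of ψ = Γ′/Γ on (0,∞). There exists a holomorphic function g on ℂ ∖ (−∞, Γ(α)] such that: g is real-valued and strictly increasing on (Γ(α), ∞) and maps (Γ(α),∞) onto (α,∞); Γ(g(w)) = w for every w ∈ ℂ ∖ (−∞, Γ(α)]; g(conj w) = conj(g(w)); and Im g(z) > 0 whenever Im z > 0. In other words, the principal inverse of Γ is a Pick function. -/

import Mathlib

open Complex

namespace GammaInverse

open Filter Topology ComplexConjugate

/-- The terms of Euler's series for the logarithm of the gamma function. -/
noncomputable def logGammaTerm (k : ℕ) (z : ℂ) : ℂ :=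
  z * (Real.log (1 + 1 / ((k : ℝ) + 1)) : ℝ) - log (1 + z / ((k : ℂ) + 1))

/-- The terms of the corresponding series for the digamma function. -/
noncomputable def psiTerm (k : ℕ) (z : ℂ) : ℂ :=
  (Real.log (1 + 1 / ((k : ℝ) + 1)) : ℝ) - (z + ((k : ℂ) + 1))⁻¹

/-- The holomorphic logarithm of the gamma function on the slit plane. -/
noncomputable def logGamma (z : ℂ) : ℂ := -log z + ∑' k, logGammaTerm k z

/-- The derivative of `logGamma`. -/
noncomputable def psi (z : ℂ) : ℂ := -z⁻¹ + ∑' k, psiTerm k z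

lemma add_natCast_mem_slitPlane {z : ℂ} (hz : z ∈ slitPlane) (k : ℕ) :
    z + ((k : ℂ) + 1) ∈ slitPlane := by
  rw [mem_slitPlane_iff] at *
  simp only [add_re, natCast_re, one_re, add_im, natCast_im, one_im, add_zero]
  rcases hz with h | h
  · left; positivity
  · exact Or.inr h

lemma one_add_div_eq (z : ℂ) (k : ℕ) :
    1 + z / ((k : ℂ) + 1) = ((((k : ℝ) + 1)⁻¹ : ℝ) : ℂ) * (z + ((k : ℂ) + 1)) := by
  have : (k : ℂ) + 1 ≠ 0 := Nat.cast_add_one_ne_zero k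
  push_cast
  field_simp
  ring

lemma one_add_div_mem_slitPlane {z : ℂ} (hz : z ∈ slitPlane) (k : ℕ) :
    1 + z / ((k : ℂ) + 1) ∈ slitPlane := by
  have h := add_natCast_mem_slitPlane hz k
  have hk : (0 : ℝ) < ((k : ℝ) + 1)⁻¹ := by positivity
  rw [one_add_div_eq, mem_slitPlane_iff, re_ofReal_mul, im_ofReal_mul]
  rw [mem_slitPlane_iff] at h
  rcases h with h | h
  · exact Or.inl (mul_pos hk h)
  · exact Or.inr (mul_ne_zero hk.ne' h)

lemma hasDerivAt_logGammaTerm {z : ℂ} (hz : z ∈ slitPlane) (k : ℕ) :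
    HasDerivAt (logGammaTerm k) (psiTerm k z) z := by
  have hk : (k : ℂ) + 1 ≠ 0 := Nat.cast_add_one_ne_zero k
  have h1 : HasDerivAt (fun z : ℂ => 1 + z / ((k : ℂ) + 1)) (1 / ((k : ℂ) + 1)) z :=
    ((hasDerivAt_id z).div_const _).const_add 1
  have h2 := h1.clog (one_add_div_mem_slitPlane hz k)
  have h3 := ((hasDerivAt_id z).mul_const
    ((Real.log (1 + 1 / ((k : ℝ) + 1)) : ℝ) : ℂ)).sub h2
  refine h3.congr_deriv ?_
  have hzk := slitPlane_ne_zero (add_natCast_mem_slitPlane hz k)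
  have hzk' := slitPlane_ne_zero (one_add_div_mem_slitPlane hz k)
  rw [psiTerm, one_mul]
  congr 1
  rw [div_div, inv_eq_one_div]
  congr 1
  field_simp
  ring

lemma summable_inv_add_one_sq : Summable fun k : ℕ => (((k : ℝ) + 1) ^ 2)⁻¹ := by
  have := (summable_nat_add_iff 1).2 (Real.summable_nat_pow_inv.2 (one_lt_two))
  simpa using this

lemma abs_log_one_add_sub_le (k : ℕ) :
    |Real.log (1 + 1 / ((k : ℝ) + 1)) - ((k : ℝ) + 1)⁻¹| ≤ (((k : ℝ) + 1) ^ 2)⁻¹ := by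
  have hk : (0 : ℝ) < (k : ℝ) + 1 := by positivity
  have hp : (0 : ℝ) < 1 + 1 / ((k : ℝ) + 1) := by positivity
  have h1 := Real.log_le_sub_one_of_pos hp
  have h2 := Real.one_sub_inv_le_log_of_pos hp
  have h3 : 1 - (1 + 1 / ((k : ℝ) + 1))⁻¹ = ((k : ℝ) + 1 + 1)⁻¹ := by
    field_simp; ring
  have h4 : ((k : ℝ) + 1)⁻¹ - ((k : ℝ) + 1 + 1)⁻¹ ≤ (((k : ℝ) + 1) ^ 2)⁻¹ := by
    rw [inv_sub_inv (by positivity) (by positivity), ← one_div]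
    apply div_le_div₀ <;> nlinarith
  rw [abs_le]
  constructor
  · linarith
  · have : (0 : ℝ) ≤ (((k : ℝ) + 1) ^ 2)⁻¹ := by positivity
    simp only [one_div] at h1
    simp only [one_div]
    linarith

/-- Quadratic decay of the digamma terms at points comparably far from `-(k + 1)`. -/
lemma norm_psiTerm_le {z : ℂ} {R C : ℝ} (hR : ‖z‖ ≤ R) (k : ℕ)
    (hC : (k : ℝ) + 1 ≤ C * ‖z + ((k : ℂ) + 1)‖) :
    ‖psiTerm k z‖ ≤ (1 + R * C) * (((k : ℝ) + 1) ^ 2)⁻¹ := by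
  have hk : (0 : ℝ) < (k : ℝ) + 1 := by positivity
  have hkc : (k : ℂ) + 1 ≠ 0 := Nat.cast_add_one_ne_zero k
  have hR0 : 0 ≤ R := (norm_nonneg z).trans hR
  have hne : z + ((k : ℂ) + 1) ≠ 0 := by
    intro h
    rw [h, norm_zero, mul_zero] at hC
    linarith
  have hn : 0 < ‖z + ((k : ℂ) + 1)‖ := norm_pos_iff.2 hne
  have e : psiTerm k z = ((Real.log (1 + 1 / ((k : ℝ) + 1)) - ((k : ℝ) + 1)⁻¹ : ℝ) : ℂ)
      + z / (((k : ℂ) + 1) * (z + ((k : ℂ) + 1))) := by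
    rw [psiTerm]; push_cast; field_simp; ring
  have hnk : ‖(k : ℂ) + 1‖ = (k : ℝ) + 1 := by
    have : ((k : ℂ) + 1) = (((k : ℝ) + 1 : ℝ) : ℂ) := by push_cast; rfl
    rw [this, norm_real, Real.norm_of_nonneg hk.le]
  rw [e]
  refine (norm_add_le _ _).trans ?_
  rw [norm_real, Real.norm_eq_abs, norm_div, norm_mul, hnk, add_mul (1 : ℝ) (R * C), one_mul]
  refine add_le_add (abs_log_one_add_sub_le k) ?_
  rw [div_le_iff₀ (by positivity), mul_assoc]
  have h1 : R * C * ((((k : ℝ) + 1) ^ 2)⁻¹ * (((k : ℝ) + 1) * ‖z + ((k : ℂ) + 1)‖))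
      = R * (C * ‖z + ((k : ℂ) + 1)‖) / ((k : ℝ) + 1) := by
    field_simp
  rw [← mul_assoc, mul_assoc (R * C), h1, le_div_iff₀ hk]
  exact mul_le_mul hR hC hk.le hR0

lemma exists_bound_psiTerm {z₀ : ℂ} (hz₀ : z₀ ∈ slitPlane) :
    ∃ r > 0, Metric.ball z₀ r ⊆ slitPlane ∧ ∃ A : ℝ, ∀ k : ℕ, ∀ z ∈ Metric.ball z₀ r,
      ‖psiTerm k z‖ ≤ A * (((k : ℝ) + 1) ^ 2)⁻¹ := by
  obtain ⟨ε, hε, hball⟩ := Metric.isOpen_iff.1 isOpen_slitPlane z₀ hz₀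
  refine ⟨ε / 2, half_pos hε, (Metric.ball_subset_ball (half_le_self hε.le)).trans hball,
    1 + (‖z₀‖ + ε) * (1 + (‖z₀‖ + ε) / (ε / 2)), fun k z hz => ?_⟩
  have hz' : dist z z₀ < ε / 2 := hz
  have hR : ‖z‖ ≤ ‖z₀‖ + ε := by
    have := norm_le_norm_add_norm_sub z₀ z
    rw [dist_eq_norm] at hz'
    rw [norm_sub_rev] at this
    linarith
  refine norm_psiTerm_le hR k ?_
  have hfar : ε / 2 ≤ ‖z + ((k : ℂ) + 1)‖ := by
    by_contra! h
    have hm : -((k : ℂ) + 1) ∈ Metric.ball z₀ ε := by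
      rw [Metric.mem_ball]
      calc dist (-((k : ℂ) + 1)) z₀ ≤ dist (-((k : ℂ) + 1)) z + dist z z₀ := dist_triangle _ _ _
        _ < ε / 2 + ε / 2 := by
          refine add_lt_add ?_ hz'
          rw [dist_comm, dist_eq_norm, sub_neg_eq_add]; exact h
        _ = ε := by ring
    have := hball hm
    rw [mem_slitPlane_iff] at this
    simp only [neg_re, add_re, natCast_re, one_re, neg_im, add_im, natCast_im, one_im, add_zero,
      neg_zero, ne_eq, not_true_eq_false, or_false] at this
    have hk : (0 : ℝ) < (k : ℝ) + 1 := by positivity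
    linarith
  have hnk : ‖(k : ℂ) + 1‖ = (k : ℝ) + 1 := by
    have : ((k : ℂ) + 1) = (((k : ℝ) + 1 : ℝ) : ℂ) := by push_cast; rfl
    rw [this, norm_real, Real.norm_of_nonneg (by positivity)]
  have h1 : (k : ℝ) + 1 ≤ ‖z + ((k : ℂ) + 1)‖ + ‖z‖ := by
    rw [← hnk]
    simpa using norm_sub_le (z + ((k : ℂ) + 1)) z
  have hX : 0 ≤ ‖z₀‖ + ε := by positivity
  have h2 : ‖z₀‖ + ε ≤ (‖z₀‖ + ε) / (ε / 2) * ‖z + ((k : ℂ) + 1)‖ := by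
    rw [div_mul_eq_mul_div, le_div_iff₀ (by positivity)]
    exact mul_le_mul_of_nonneg_left hfar hX
  linarith

lemma summable_psiTerm {z : ℂ} (hz : z ∈ slitPlane) : Summable fun k => psiTerm k z := by
  obtain ⟨r, hr, -, A, hA⟩ := exists_bound_psiTerm hz
  exact .of_norm_bounded (summable_inv_add_one_sq.mul_left A)
    fun k => hA k z (Metric.mem_ball_self hr)

lemma summable_logGammaTerm (z : ℂ) : Summable fun k => logGammaTerm k z := by
  refine .of_norm_bounded_eventually_nat
    (summable_inv_add_one_sq.mul_left (‖z‖ + ‖z‖ ^ 2)) ?_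
  filter_upwards [eventually_ge_atTop ⌈2 * ‖z‖⌉₊] with k hk
  have hkz : 2 * ‖z‖ ≤ k := (Nat.le_ceil _).trans (by exact_mod_cast hk)
  have hk0 : (0 : ℝ) < (k : ℝ) + 1 := by positivity
  have hkc : (k : ℂ) + 1 ≠ 0 := Nat.cast_add_one_ne_zero k
  have hnk : ‖(k : ℂ) + 1‖ = (k : ℝ) + 1 := by
    have : ((k : ℂ) + 1) = (((k : ℝ) + 1 : ℝ) : ℂ) := by push_cast; rfl
    rw [this, norm_real, Real.norm_of_nonneg hk0.le]
  have e : logGammaTerm k z = z * ((Real.log (1 + 1 / ((k : ℝ) + 1)) - ((k : ℝ) + 1)⁻¹ : ℝ) : ℂ)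
      - (log (1 + z / ((k : ℂ) + 1)) - z / ((k : ℂ) + 1)) := by
    rw [logGammaTerm]; push_cast; field_simp; ring
  have hw : ‖z / ((k : ℂ) + 1)‖ = ‖z‖ / ((k : ℝ) + 1) := by rw [norm_div, hnk]
  have hhalf : ‖z / ((k : ℂ) + 1)‖ ≤ 1 / 2 := by
    rw [hw, div_le_iff₀ hk0]; linarith
  have hlog := norm_log_one_add_sub_self_le (hhalf.trans_lt one_half_lt_one)
  have hlog' : ‖log (1 + z / ((k : ℂ) + 1)) - z / ((k : ℂ) + 1)‖
      ≤ ‖z‖ ^ 2 * (((k : ℝ) + 1) ^ 2)⁻¹ := by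
    refine hlog.trans ?_
    have h2 : (1 - ‖z / ((k : ℂ) + 1)‖)⁻¹ ≤ 2 := by
      rw [inv_le_comm₀ (by linarith) two_pos]; linarith
    calc ‖z / ((k : ℂ) + 1)‖ ^ 2 * (1 - ‖z / ((k : ℂ) + 1)‖)⁻¹ / 2
        ≤ ‖z / ((k : ℂ) + 1)‖ ^ 2 * 2 / 2 := by gcongr
      _ = ‖z‖ ^ 2 * (((k : ℝ) + 1) ^ 2)⁻¹ := by rw [hw]; field_simp
  rw [e]
  refine (norm_sub_le _ _).trans ?_
  rw [norm_mul, norm_real, Real.norm_eq_abs, add_mul]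
  exact add_le_add (mul_le_mul_of_nonneg_left (abs_log_one_add_sub_le k) (norm_nonneg z)) hlog'

lemma hasDerivAt_logGamma {z : ℂ} (hz : z ∈ slitPlane) :
    HasDerivAt logGamma (psi z) z := by
  obtain ⟨r, hr, hsub, A, hA⟩ := exists_bound_psiTerm hz
  have hzr := Metric.mem_ball_self (x := z) hr
  exact (hasDerivAt_log hz).neg.add <| hasDerivAt_tsum_of_isPreconnected
    (summable_inv_add_one_sq.mul_left A) Metric.isOpen_ball
    (convex_ball z r).isPreconnected (fun k y hy => hasDerivAt_logGammaTerm (hsub hy) k) hA hzr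
    (summable_logGammaTerm z) hzr

lemma exp_logGammaTerm_mul {z : ℂ} (hz : z ∈ slitPlane) (k : ℕ) :
    exp (logGammaTerm k z) * (z + ((k : ℂ) + 1)) * exp (z * (Real.log ((k : ℝ) + 1) : ℝ))
      = exp (z * (Real.log ((k : ℝ) + 1 + 1) : ℝ)) * ((k : ℂ) + 1) := by
  have hk0 : (0 : ℝ) < (k : ℝ) + 1 := by positivity
  have hkc : (k : ℂ) + 1 ≠ 0 := Nat.cast_add_one_ne_zero k
  have hne := slitPlane_ne_zero (one_add_div_mem_slitPlane hz k)
  have hlog : Real.log (1 + 1 / ((k : ℝ) + 1))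
      = Real.log ((k : ℝ) + 1 + 1) - Real.log ((k : ℝ) + 1) := by
    rw [← Real.log_div (by positivity) hk0.ne']
    congr 1
    field_simp
  have hzk : z + ((k : ℂ) + 1) = ((k : ℂ) + 1) * (1 + z / ((k : ℂ) + 1)) := by
    field_simp; ring
  rw [logGammaTerm, hlog, exp_sub, exp_log hne, ofReal_sub, mul_sub, exp_sub, hzk]
  generalize 1 + z / ((k : ℂ) + 1) = w at hne ⊢
  have := exp_ne_zero (z * (Real.log ((k : ℝ) + 1) : ℝ))
  field_simp

lemma exp_partialSum_mul_prod {z : ℂ} (hz : z ∈ slitPlane) (n : ℕ) :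
    exp (-log z + ∑ k ∈ Finset.range n, logGammaTerm k z) * ∏ j ∈ Finset.range (n + 1), (z + j)
      = exp (z * (Real.log ((n : ℝ) + 1) : ℝ)) * (n.factorial : ℂ) := by
  induction n with
  | zero => simp [exp_neg, exp_log (slitPlane_ne_zero hz), slitPlane_ne_zero hz]
  | succ n ih =>
    have h := exp_logGammaTerm_mul hz n
    have hne := exp_ne_zero (z * (Real.log ((n : ℝ) + 1) : ℝ))
    rw [Finset.sum_range_succ, Finset.prod_range_succ, ← add_assoc, exp_add, Nat.factorial_succ]
    apply mul_right_cancel₀ hne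
    push_cast at h ih ⊢
    linear_combination (exp (logGammaTerm n z) * (z + (n + 1)) *
      exp (z * (Real.log ((n : ℝ) + 1) : ℝ))) * ih
      + (exp (z * (Real.log ((n : ℝ) + 1) : ℝ)) * (n.factorial : ℂ)) * h

lemma exp_logGamma {z : ℂ} (hz : z ∈ slitPlane) : exp (logGamma z) = Gamma z := by
  have h1 : Tendsto (fun n => exp (-log z + ∑ k ∈ Finset.range n, logGammaTerm k z)) atTop
      (𝓝 (exp (logGamma z))) :=
    (continuous_exp.tendsto _).comp
      ((summable_logGammaTerm z).hasSum.tendsto_sum_nat.const_add (-log z))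
  have h2 := (tendsto_natCast_div_add_atTop z).comp (tendsto_add_atTop_nat 1)
  have h3 := (GammaSeq_tendsto_Gamma z).comp (tendsto_add_atTop_nat 1)
  have h4 := h1.mul h2
  rw [mul_one] at h4
  refine tendsto_nhds_unique (h4.congr fun n => ?_) h3
  have hP := exp_partialSum_mul_prod hz n
  have hzn : z + ((n : ℂ) + 1) ≠ 0 := slitPlane_ne_zero (add_natCast_mem_slitPlane hz n)
  have hprod : ∏ j ∈ Finset.range (n + 1), (z + (j : ℂ)) ≠ 0 := by
    refine Finset.prod_ne_zero_iff.2 fun j _ => ?_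
    cases j with
    | zero => simpa using slitPlane_ne_zero hz
    | succ j => simpa using slitPlane_ne_zero (add_natCast_mem_slitPlane hz j)
  have hpow : ((n + 1 : ℕ) : ℂ) ^ z = exp (z * (Real.log ((n : ℝ) + 1) : ℝ)) := by
    rw [cpow_def_of_ne_zero (by exact_mod_cast Nat.succ_ne_zero n), ofReal_log (by positivity),
      mul_comm]
    push_cast
    rfl
  simp only [Function.comp_apply, GammaSeq]
  rw [Finset.prod_range_succ, hpow, Nat.factorial_succ]
  push_cast at hP hzn hprod ⊢
  have hzn' : (n : ℂ) + 1 + z ≠ 0 := by rwa [add_comm]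
  rw [mul_div_assoc', div_eq_div_iff hzn' (mul_ne_zero hprod hzn)]
  linear_combination (((n : ℂ) + 1) * (z + ((n : ℂ) + 1))) * hP

lemma logGamma_conj {z : ℂ} (hz : z ∈ slitPlane) : logGamma (conj z) = conj (logGamma z) := by
  rw [logGamma, logGamma, map_add, map_neg, conj_tsum, log_conj z (slitPlane_arg_ne_pi hz)]
  congr 1
  refine tsum_congr fun k => ?_
  rw [logGammaTerm, logGammaTerm, map_sub, map_mul, conj_ofReal,
    ← log_conj _ (slitPlane_arg_ne_pi (one_add_div_mem_slitPlane hz k))]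
  simp

lemma logGamma_im_ofReal {x : ℝ} (hx : 0 < x) : (logGamma x).im = 0 := by
  rw [← conj_eq_iff_im, ← logGamma_conj (ofReal_mem_slitPlane.2 hx), conj_ofReal]

lemma logGamma_ofReal {x : ℝ} (hx : 0 < x) : logGamma x = (Real.log (Real.Gamma x) : ℝ) := by
  have him := logGamma_im_ofReal hx
  have hre : logGamma x = ((logGamma x).re : ℝ) := by
    apply Complex.ext <;> simp [him]
  have h := exp_logGamma (ofReal_mem_slitPlane.2 hx)
  rw [hre, ← ofReal_exp, Gamma_ofReal, ofReal_inj] at h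
  rw [hre, ← h, Real.log_exp]

lemma neg_inv_im (z : ℂ) : (-z⁻¹).im = z.im / normSq z := by
  rw [neg_im, inv_im, neg_div, neg_neg]

lemma psiTerm_im (k : ℕ) (z : ℂ) : (psiTerm k z).im = z.im / normSq (z + ((k : ℂ) + 1)) := by
  have := neg_inv_im (z + ((k : ℂ) + 1))
  rw [neg_im] at this
  rw [psiTerm, sub_im, ofReal_im, zero_sub, this]
  simp

lemma psi_im {z : ℂ} (hz : z ∈ slitPlane) :
    (psi z).im = z.im / normSq z + ∑' k : ℕ, z.im / normSq (z + ((k : ℂ) + 1)) := by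
  rw [psi, add_im, neg_inv_im, im_tsum (summable_psiTerm hz)]
  simp_rw [psiTerm_im]

lemma psi_im_pos {z : ℂ} (hz : 0 < z.im) : 0 < (psi z).im := by
  have hs : z ∈ slitPlane := mem_slitPlane_iff.2 (Or.inr hz.ne')
  rw [psi_im hs]
  refine add_pos_of_pos_of_nonneg (div_pos hz (normSq_pos.2 (slitPlane_ne_zero hs))) ?_
  exact tsum_nonneg fun k => div_nonneg hz.le (normSq_nonneg _)

lemma psi_im_neg {z : ℂ} (hz : z.im < 0) : (psi z).im < 0 := by
  have hs : z ∈ slitPlane := mem_slitPlane_iff.2 (Or.inr hz.ne)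
  rw [psi_im hs]
  refine add_neg_of_neg_of_nonpos (div_neg_of_neg_of_pos hz
    (normSq_pos.2 (slitPlane_ne_zero hs))) ?_
  exact tsum_nonpos fun k => div_nonpos_of_nonpos_of_nonneg hz.le (normSq_nonneg _)

/-- The digamma function has imaginary part bounded below on quadrants in the upper half plane. -/
lemma exists_le_psi_im (M : ℝ) {y₀ : ℝ} (hy₀ : 0 < y₀) :
    ∃ c > 0, ∀ z : ℂ, z.re ≤ M → y₀ ≤ z.im → c ≤ (psi z).im := by
  set B : ℝ := |M| + 3 with hB
  have hBpos : 0 < B := by positivity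
  refine ⟨1 / ((B / y₀ + 1) ^ 2 + 1), by positivity, fun z hx hy => ?_⟩
  have hy0 : 0 < z.im := hy₀.trans_le hy
  have hs : z ∈ slitPlane := mem_slitPlane_iff.2 (Or.inr hy0.ne')
  set j : ℕ := ⌈-z.re⌉₊
  set N : ℕ := ⌈z.im⌉₊
  have hj1 : -z.re ≤ j := Nat.le_ceil _
  have hj2 : z.re + j ≤ |M| + 1 := by
    rcases le_total 0 (-z.re) with h | h
    · have := Nat.ceil_lt_add_one h
      have := abs_nonneg M
      simp only [j]; linarith
    · have : j = 0 := Nat.ceil_eq_zero.2 h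
      rw [this]
      have := le_abs_self M
      simp; linarith
  have hN1 : z.im ≤ N := Nat.le_ceil _
  have hN2 : (N : ℝ) ≤ z.im + 1 := (Nat.ceil_lt_add_one hy0.le).le
  have hsum : Summable fun k : ℕ => z.im / normSq (z + ((k : ℂ) + 1)) := by
    have := (hasSum_im (summable_psiTerm hs).hasSum).summable
    simpa only [psiTerm_im] using this
  have hterm : ∀ k ∈ Finset.Ico j (j + N),
      z.im / ((B + z.im) ^ 2 + z.im ^ 2) ≤ z.im / normSq (z + ((k : ℂ) + 1)) := by
    intro k hk
    rw [Finset.mem_Ico] at hk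
    have hk1 : (j : ℝ) ≤ k := by exact_mod_cast hk.1
    have hk2 : (k : ℝ) + 1 ≤ j + N := by exact_mod_cast hk.2
    refine div_le_div_of_nonneg_left hy0.le
      (normSq_pos.2 (slitPlane_ne_zero (add_natCast_mem_slitPlane hs k))) ?_
    rw [normSq_apply]
    simp only [add_re, natCast_re, one_re, add_im, natCast_im, one_im, add_zero]
    have : (z.re + (k + 1)) ^ 2 ≤ (B + z.im) ^ 2 :=
      pow_le_pow_left₀ (by linarith) (by linarith) 2
    nlinarith
  have h1 := Finset.sum_le_sum hterm
  have h2 := hsum.sum_le_tsum (Finset.Ico j (j + N))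
    fun k _ => div_nonneg hy0.le (normSq_nonneg _)
  rw [Finset.sum_const, Nat.card_Ico, Nat.add_sub_cancel_left, nsmul_eq_mul] at h1
  have h3 : 0 ≤ z.im / normSq z := div_nonneg hy0.le (normSq_nonneg _)
  have hD : 0 < (B + z.im) ^ 2 + z.im ^ 2 := by positivity
  have h4 : z.im * (z.im / ((B + z.im) ^ 2 + z.im ^ 2))
      ≤ N * (z.im / ((B + z.im) ^ 2 + z.im ^ 2)) := by gcongr
  have h5 : 1 / ((B / y₀ + 1) ^ 2 + 1) ≤ z.im * (z.im / ((B + z.im) ^ 2 + z.im ^ 2)) := by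
    rw [mul_div_assoc', div_le_div_iff₀ (by positivity) hD, one_mul]
    have hBy : B + z.im ≤ (B / y₀ + 1) * z.im := by
      have : B ≤ B / y₀ * z.im := by
        rw [div_mul_eq_mul_div, le_div_iff₀ hy₀]
        exact mul_le_mul_of_nonneg_left hy hBpos.le
      linarith
    have := pow_le_pow_left₀ (by positivity) hBy 2
    nlinarith
  rw [psi_im hs]
  linarith

lemma inv_re_le_inv {a : ℝ} (ha : 0 < a) {z : ℂ} (hz : a ≤ z.re) : (z⁻¹).re ≤ a⁻¹ :=
  calc (z⁻¹).re ≤ ‖z⁻¹‖ := re_le_norm _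
    _ = ‖z‖⁻¹ := norm_inv z
    _ ≤ a⁻¹ := inv_anti₀ ha (hz.trans (re_le_norm z))

/-- The real part of the digamma function dominates its values at real points to the left. -/
lemma psi_re_lt {a : ℝ} (ha : 0 < a) {z : ℂ} (hz : a < z.re) : (psi a).re < (psi z).re := by
  have has : (a : ℂ) ∈ slitPlane := ofReal_mem_slitPlane.2 ha
  have hzs : z ∈ slitPlane := mem_slitPlane_iff.2 (Or.inl (ha.trans hz))
  rw [psi, psi, add_re, add_re, re_tsum (summable_psiTerm has), re_tsum (summable_psiTerm hzs)]
  refine add_lt_add_of_lt_of_le ?_ ?_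
  · rw [neg_re, neg_re, neg_lt_neg_iff, ← ofReal_inv, ofReal_re]
    exact (inv_re_le_inv (ha.trans hz) le_rfl).trans_lt (inv_strictAnti₀ ha hz)
  · refine (hasSum_re (summable_psiTerm has).hasSum).summable.tsum_le_tsum (fun k => ?_)
      (hasSum_re (summable_psiTerm hzs).hasSum).summable
    rw [psiTerm, psiTerm, sub_re, sub_re]
    refine sub_le_sub_left ?_ _
    have e : ((a : ℂ) + ((k : ℂ) + 1))⁻¹ = ((a + (k + 1))⁻¹ : ℝ) := by push_cast; rfl
    rw [e, ofReal_re]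
    exact inv_re_le_inv (by positivity) (by simp; linarith)

/-- A mean value theorem for holomorphic functions on convex sets. -/
lemma exists_re_mul_sub_eq {f f' : ℂ → ℂ} {s : Set ℂ} (hs : Convex ℝ s)
    (hf : ∀ z ∈ s, HasDerivAt f (f' z) z) (c : ℂ) {a b : ℂ} (ha : a ∈ s) (hb : b ∈ s) :
    ∃ ξ ∈ s, (c * (f b - f a) * conj (b - a)).re = (c * f' ξ).re * ‖b - a‖ ^ 2 := by
  have hmem : ∀ t ∈ Set.Icc (0 : ℝ) 1, a + (t : ℂ) * (b - a) ∈ s := by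
    intro t ht
    have := hs.add_smul_sub_mem ha hb ht
    simpa using this
  have hd : ∀ t ∈ Set.Icc (0 : ℝ) 1,
      HasDerivAt (fun t : ℝ => (c * f (a + (t : ℂ) * (b - a)) * conj (b - a)).re)
        ((c * f' (a + (t : ℂ) * (b - a))).re * ‖b - a‖ ^ 2) t := by
    intro t ht
    have h1 : HasDerivAt (fun u : ℂ => a + u * (b - a)) (b - a) (t : ℂ) := by
      simpa using ((hasDerivAt_id (t : ℂ)).mul_const (b - a)).const_add a
    have h2 := (((hf _ (hmem t ht)).comp (t : ℂ) h1).const_mul c).mul_const (conj (b - a))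
    refine h2.real_of_complex.congr_deriv ?_
    rw [← re_mul_ofReal]
    congr 1
    have : (b - a) * conj (b - a) = ((‖b - a‖ ^ 2 : ℝ) : ℂ) := by
      rw [mul_conj, normSq_eq_norm_sq]
    rw [← this]
    ring
  obtain ⟨t, ht, hslope⟩ := exists_hasDerivAt_eq_slope _ _ zero_lt_one
    (fun t ht => (hd t ht).continuousAt.continuousWithinAt)
    (fun t ht => hd t (Set.Ioo_subset_Icc_self ht))
  refine ⟨_, hmem t (Set.Ioo_subset_Icc_self ht), ?_⟩
  rw [hslope, ofReal_one, ofReal_zero, one_mul, zero_mul, add_zero, add_sub_cancel, sub_zero,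
    div_one, ← sub_re, ← sub_mul, ← mul_sub]

lemma mul_dist_le_of_le_re {f f' : ℂ → ℂ} {s : Set ℂ} (hs : Convex ℝ s)
    (hf : ∀ z ∈ s, HasDerivAt f (f' z) z) {c : ℂ} (hc : ‖c‖ = 1) {m : ℝ}
    (hm : ∀ z ∈ s, m ≤ (c * f' z).re) {a b : ℂ} (ha : a ∈ s) (hb : b ∈ s) :
    m * dist b a ≤ dist (f b) (f a) := by
  obtain ⟨ξ, hξ, h⟩ := exists_re_mul_sub_eq hs hf c ha hb
  rcases eq_or_ne b a with rfl | hne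
  · simp
  have hpos : 0 < ‖b - a‖ := norm_pos_iff.2 (sub_ne_zero.2 hne)
  have h1 : (c * (f b - f a) * conj (b - a)).re ≤ ‖f b - f a‖ * ‖b - a‖ := by
    refine (re_le_norm _).trans_eq ?_
    rw [norm_mul, norm_mul, hc, one_mul, norm_conj]
  rw [h] at h1
  have h2 : m * ‖b - a‖ ^ 2 ≤ ‖f b - f a‖ * ‖b - a‖ :=
    (mul_le_mul_of_nonneg_right (hm ξ hξ) (by positivity)).trans h1
  rw [dist_eq_norm, dist_eq_norm]
  refine le_of_mul_le_mul_right ?_ hpos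
  rwa [mul_assoc, ← sq]

/-- A holomorphic function whose derivative stays in a half plane away from the origin maps closed
convex sets to closed sets. -/
lemma isClosed_image_of_le_re {f f' : ℂ → ℂ} {s : Set ℂ} (hs : Convex ℝ s) (hcl : IsClosed s)
    (hf : ∀ z ∈ s, HasDerivAt f (f' z) z) {c : ℂ} (hc : ‖c‖ = 1) {m : ℝ} (hm0 : 0 < m)
    (hm : ∀ z ∈ s, m ≤ (c * f' z).re) : IsClosed (f '' s) := by
  refine isSeqClosed_iff_isClosed.1 ?_
  intro u w hu huw
  choose z hz hfz using hu
  have hcau : CauchySeq z := by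
    rw [Metric.cauchySeq_iff']
    intro ε hε
    obtain ⟨N, hN⟩ := Metric.cauchySeq_iff'.1 huw.cauchySeq (m * ε) (by positivity)
    refine ⟨N, fun n hn => ?_⟩
    have h1 := mul_dist_le_of_le_re hs hf hc hm (hz N) (hz n)
    rw [hfz, hfz] at h1
    exact lt_of_mul_lt_mul_left (h1.trans_lt (hN n hn)) hm0.le
  obtain ⟨z', hz'⟩ := cauchySeq_tendsto_of_complete hcau
  have hz's : z' ∈ s := hcl.mem_of_tendsto hz' (Eventually.of_forall hz)
  refine ⟨z', hz's, tendsto_nhds_unique ?_ huw⟩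
  have := (hf z' hz's).continuousAt.tendsto.comp hz'
  refine this.congr fun n => hfz n

lemma mem_slitPlane_of_im_pos {z : ℂ} (hz : 0 < z.im) : z ∈ slitPlane :=
  mem_slitPlane_iff.2 (Or.inr hz.ne')

lemma convex_im_pos : Convex ℝ {z : ℂ | 0 < z.im} := convex_halfSpace_im_gt 0

lemma hasStrictDerivAt_logGamma {z : ℂ} (hz : z ∈ slitPlane) :
    HasStrictDerivAt logGamma (psi z) z := by
  have hd : DifferentiableOn ℂ logGamma slitPlane := fun w hw =>
    (hasDerivAt_logGamma hw).differentiableAt.differentiableWithinAt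
  have := (hd.analyticAt (isOpen_slitPlane.mem_nhds hz)).hasStrictDerivAt
  rwa [(hasDerivAt_logGamma hz).deriv] at this

lemma logGamma_injOn_im_pos : Set.InjOn logGamma {z : ℂ | 0 < z.im} := by
  intro a ha b hb hab
  obtain ⟨ξ, hξ, h⟩ := exists_re_mul_sub_eq convex_im_pos
    (fun z hz => hasDerivAt_logGamma (mem_slitPlane_of_im_pos hz)) (-I) ha hb
  have hpos : 0 < (-I * psi ξ).re := by simpa using psi_im_pos hξ
  rw [hab, sub_self, mul_zero, zero_mul, zero_re, eq_comm, mul_eq_zero] at h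
  have := h.resolve_left hpos.ne'
  rw [sq_eq_zero_iff, norm_eq_zero, sub_eq_zero] at this
  exact this.symm

lemma logGamma_im_le {z : ℂ} (hz : 0 < z.im) {M : ℝ} (hM : z.re ≤ M) :
    (logGamma z).im ≤ (logGamma ⟨M, z.im⟩).im := by
  rcases hM.eq_or_lt with rfl | hlt
  · rfl
  obtain ⟨ξ, hξ, h⟩ := exists_re_mul_sub_eq convex_im_pos
    (fun z hz => hasDerivAt_logGamma (mem_slitPlane_of_im_pos hz)) (-I)
    (a := z) (b := ⟨M, z.im⟩) hz hz
  have hsub : (⟨M, z.im⟩ - z : ℂ) = ((M - z.re : ℝ) : ℂ) := by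
    apply Complex.ext <;> simp
  have hpos : 0 < (-I * psi ξ).re := by simpa using psi_im_pos hξ
  rw [hsub, conj_ofReal, re_mul_ofReal] at h
  have hr : 0 ≤ (-I * (logGamma ⟨M, z.im⟩ - logGamma z)).re * (M - z.re) := by
    rw [h]; positivity
  have := nonneg_of_mul_nonneg_left hr (sub_pos.2 hlt)
  simpa using this

section Critical

variable {α : ℝ}

lemma psi_re_pos (hα : 0 < α) (hψ : (psi α).re = 0) {z : ℂ} (hz : α < z.re) :
    0 < (psi z).re :=
  hψ ▸ psi_re_lt hα hz

/-- A lower bound for the imaginary part of `logGamma` on vertical lines. -/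
lemma le_logGamma_im {m x : ℝ} (hx : 0 < x) (hm : ∀ z : ℂ, x ≤ z.re → m ≤ (psi z).re)
    {y : ℝ} (hy : 0 < y) : m * y ≤ (logGamma ⟨x, y⟩).im := by
  obtain ⟨ξ, hξ, h⟩ := exists_re_mul_sub_eq (s := {z : ℂ | x ≤ z.re}) (convex_halfSpace_re_ge x)
    (fun z hz => hasDerivAt_logGamma (mem_slitPlane_iff.2 (Or.inl (hx.trans_le hz)))) 1
    (a := x) (b := ⟨x, y⟩) (by simp) (by simp)
  have hsub : (⟨x, y⟩ - x : ℂ) = (y : ℂ) * I := by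
    apply Complex.ext <;> simp
  have him := logGamma_im_ofReal hx
  rw [hsub, one_mul, one_mul, map_mul, conj_ofReal, conj_I, norm_mul, norm_I, mul_one,
    norm_real, Real.norm_of_nonneg hy.le] at h
  simp only [mul_re, sub_re, ofReal_re, neg_re, I_re, mul_zero, ofReal_im, I_im,
    mul_neg, mul_one, sub_im, him, mul_im, sub_zero] at h
  have := mul_le_mul_of_nonneg_right (hm ξ hξ) (sq_nonneg y)
  refine le_of_mul_le_mul_right ?_ hy
  nlinarith

lemma logGamma_im_pos (hα : 0 < α) (hψ : (psi α).re = 0) {z : ℂ} (hz : α < z.re)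
    (hy : 0 < z.im) : 0 < (logGamma z).im := by
  obtain ⟨a, ha, haz⟩ := exists_between hz
  exact (mul_pos (psi_re_pos hα hψ (z := a) (by simpa using ha)) hy).trans_le
    (le_logGamma_im (hα.trans hz) (fun w hw => (psi_re_lt (hα.trans ha) (haz.trans_le hw)).le) hy)

lemma isOpen_logGamma_image_im_pos : IsOpen (logGamma '' {z : ℂ | 0 < z.im}) := by
  rw [isOpen_iff_mem_nhds]
  rintro _ ⟨z, hz, rfl⟩
  have hne : psi z ≠ 0 := fun h => by simpa [h] using psi_im_pos hz
  rw [← (hasStrictDerivAt_logGamma (mem_slitPlane_of_im_pos hz)).map_nhds_eq hne]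
  exact image_mem_map ((isOpen_lt continuous_const continuous_im).mem_nhds hz)

/-- `logGamma` maps the upper half plane onto a set containing the upper half plane. -/
lemma exists_logGamma_eq (hα : 0 < α) (hψ : (psi α).re = 0) {ζ : ℂ} (hζ : 0 < ζ.im) :
    ∃ z : ℂ, 0 < z.im ∧ logGamma z = ζ := by
  obtain ⟨η, hη, hηζ⟩ := exists_between hζ
  set M : ℝ := α + 2 with hM
  have hM0 : 0 < M := by positivity
  set m : ℝ := (psi ((α + 1 : ℝ) : ℂ)).re with hm
  have hm0 : 0 < m := psi_re_pos hα hψ (by simp)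
  have hmle : ∀ z : ℂ, M ≤ z.re → m ≤ (psi z).re := fun z hz =>
    (psi_re_lt (by positivity) (by linarith)).le
  obtain ⟨y₀, hy₀, hsmall⟩ : ∃ y₀ > 0, ∀ y : ℝ, 0 < y → y < y₀ → (logGamma ⟨M, y⟩).im < η := by
    have hc : ContinuousAt (fun y : ℝ => (logGamma (M + y * I)).im) 0 := by
      have h1 : ContinuousAt logGamma ((M : ℂ) + ((0 : ℝ) : ℂ) * I) := by
        simpa using (hasDerivAt_logGamma (ofReal_mem_slitPlane.2 hM0)).continuousAt
      exact continuous_im.continuousAt.comp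
        (ContinuousAt.comp (f := fun y : ℝ => (M : ℂ) + (y : ℂ) * I) h1 (by fun_prop))
    have h0 : (logGamma (M + ((0 : ℝ) : ℂ) * I)).im < η := by
      simpa [logGamma_im_ofReal hM0] using hη
    obtain ⟨y₀, hy₀, h⟩ := Metric.eventually_nhds_iff.1 (hc.eventually_lt_const h0)
    refine ⟨y₀, hy₀, fun y hy hlt => ?_⟩
    rw [mk_eq_add_mul_I]
    exact h (by rwa [Real.dist_eq, sub_zero, abs_of_pos hy])
  obtain ⟨c, hc0, hc⟩ := exists_le_psi_im M hy₀
  set K : Set ℂ := {z | z.re ≤ M} ∩ {z | y₀ ≤ z.im} with hK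
  set H : Set ℂ := {z | M ≤ z.re} ∩ {z | 0 ≤ z.im} with hH
  have hKcl : IsClosed (logGamma '' K) :=
    isClosed_image_of_le_re (c := -I) (f' := psi)
      ((convex_halfSpace_re_le M).inter (convex_halfSpace_im_ge y₀))
      ((isClosed_le continuous_re continuous_const).inter
        (isClosed_le continuous_const continuous_im))
      (fun z hz => hasDerivAt_logGamma (mem_slitPlane_of_im_pos (hy₀.trans_le hz.2)))
      (by simp) hc0 (fun z hz => by simpa using hc z hz.1 hz.2)
  have hHcl : IsClosed (logGamma '' H) :=
    isClosed_image_of_le_re (c := 1) (f' := psi)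
      ((convex_halfSpace_re_ge M).inter (convex_halfSpace_im_ge 0))
      ((isClosed_le continuous_const continuous_re).inter
        (isClosed_le continuous_const continuous_im))
      (fun z hz => hasDerivAt_logGamma (mem_slitPlane_iff.2 (Or.inl (hM0.trans_le hz.1))))
      (by simp) hm0 (fun z hz => by simpa using hmle z hz.1)
  set T : Set ℂ := {ω | η < ω.im} with hT
  set V : Set ℂ := logGamma '' {z : ℂ | 0 < z.im} ∩ T with hV
  have hVopen : IsOpen V :=
    isOpen_logGamma_image_im_pos.inter (isOpen_lt continuous_const continuous_im)
  have hVsub : V ⊆ logGamma '' K ∪ logGamma '' H := by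
    rintro _ ⟨⟨z, hz, rfl⟩, hzT⟩
    have hz' : 0 < z.im := hz
    rcases le_total M z.re with h | h
    · exact Or.inr ⟨z, ⟨h, hz'.le⟩, rfl⟩
    · refine Or.inl ⟨z, ⟨h, ?_⟩, rfl⟩
      by_contra hlt
      exact lt_asymm ((logGamma_im_le hz' h).trans_lt (hsmall _ hz' (not_le.1 hlt))) hzT
  have hclosure : closure V ∩ T ⊆ V := by
    rintro ω ⟨hω, hωT⟩
    refine ⟨?_, hωT⟩
    rcases closure_minimal hVsub (hKcl.union hHcl) hω with ⟨z, hz, rfl⟩ | ⟨z, hz, rfl⟩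
    · exact ⟨z, hy₀.trans_le hz.2, rfl⟩
    · refine ⟨z, show 0 < z.im from lt_of_le_of_ne hz.2 fun h0 => ?_, rfl⟩
      have hzr : z = (z.re : ℂ) := by apply Complex.ext <;> simp [← h0]
      have hωT' : η < (logGamma z).im := hωT
      rw [hzr, logGamma_im_ofReal (hM0.trans_le hz.1)] at hωT'
      exact lt_asymm hη hωT'
  have hne : (T ∩ V).Nonempty := by
    have hY : 0 < (η + 1) / m := by positivity
    have h1 := le_logGamma_im hM0 hmle hY
    rw [mul_div_cancel₀ _ hm0.ne'] at h1
    have h2 : logGamma ⟨M, (η + 1) / m⟩ ∈ T := (lt_add_one η).trans_le h1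
    exact ⟨_, h2, ⟨_, hY, rfl⟩, h2⟩
  obtain ⟨⟨z, hz, hzζ⟩, -⟩ :=
    (convex_halfSpace_im_gt η).isPreconnected.subset_of_closure_inter_subset
      hVopen hne hclosure (show ζ ∈ T from hηζ)
  exact ⟨z, hz, hzζ⟩

lemma hasDerivAt_Gamma_ofReal {a : ℝ} (ha : 0 < a) :
    HasDerivAt Real.Gamma (Real.Gamma a * (psi a).re) a := by
  have has : (a : ℂ) ∈ slitPlane := ofReal_mem_slitPlane.2 ha
  have h1 : HasDerivAt Gamma (exp (logGamma a) * psi a) a := by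
    refine (hasDerivAt_logGamma has).cexp.congr_of_eventuallyEq ?_
    filter_upwards [isOpen_slitPlane.mem_nhds has] with z hz using (exp_logGamma hz).symm
  have h2 := h1.real_of_complex
  simp only [Gamma_ofReal, ofReal_re] at h2
  rwa [exp_logGamma has, Gamma_ofReal, re_ofReal_mul] at h2

lemma psi_re_eq_zero_of_deriv_Gamma {a : ℝ} (ha : 0 < a) (h : deriv Real.Gamma a = 0) :
    (psi a).re = 0 := by
  rw [(hasDerivAt_Gamma_ofReal ha).deriv] at h
  exact (mul_eq_zero.1 h).resolve_left (Real.Gamma_pos_of_pos ha).ne'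

lemma strictMonoOn_Gamma (hα : 0 < α) (hψ : (psi α).re = 0) :
    StrictMonoOn Real.Gamma (Set.Ici α) := by
  refine strictMonoOn_of_deriv_pos (convex_Ici α) (fun x hx =>
    (hasDerivAt_Gamma_ofReal (hα.trans_le hx)).continuousAt.continuousWithinAt) fun x hx => ?_
  rw [interior_Ici] at hx
  have hx0 : 0 < x := hα.trans hx
  rw [(hasDerivAt_Gamma_ofReal hx0).deriv]
  exact mul_pos (Real.Gamma_pos_of_pos hx0) (psi_re_pos hα hψ (by simpa using hx))

lemma exists_Gamma_eq (hα : 0 < α) {w : ℝ} (hw : Real.Gamma α < w) :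
    ∃ x, α < x ∧ Real.Gamma x = w := by
  set n : ℕ := max ⌈α⌉₊ ⌈w⌉₊ with hn
  have hαn : α ≤ (n : ℝ) + 1 :=
    ((Nat.le_ceil α).trans (by exact_mod_cast le_max_left _ _)).trans (le_add_of_nonneg_right
      zero_le_one)
  have hwn : w ≤ Real.Gamma ((n : ℝ) + 1) := by
    rw [Real.Gamma_nat_eq_factorial]
    exact (Nat.le_ceil w).trans (by exact_mod_cast (le_max_right _ _).trans n.self_le_factorial)
  have hcont : ContinuousOn Real.Gamma (Set.Icc α ((n : ℝ) + 1)) := fun x hx =>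
    (hasDerivAt_Gamma_ofReal (hα.trans_le hx.1)).continuousAt.continuousWithinAt
  obtain ⟨x, hx, hxw⟩ := intermediate_value_Icc hαn hcont ⟨hw.le, hwn⟩
  refine ⟨x, lt_of_le_of_ne hx.1 ?_, hxw⟩
  rintro rfl
  exact hw.ne hxw

/-- The image of the principal inverse of the gamma function. -/
def principalDomain (α : ℝ) : Set ℂ :=
  {z | α < z.re ∨ (0 < z.im ∧ 0 < (logGamma z).im) ∨ (z.im < 0 ∧ (logGamma z).im < 0)}

lemma principalDomain_subset_slitPlane (hα : 0 < α) : principalDomain α ⊆ slitPlane := by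
  rintro z (h | h | h)
  · exact mem_slitPlane_iff.2 (Or.inl (hα.trans h))
  · exact mem_slitPlane_of_im_pos h.1
  · exact mem_slitPlane_iff.2 (Or.inr h.1.ne)

lemma isOpen_principalDomain (hα : 0 < α) : IsOpen (principalDomain α) := by
  have hcont : ContinuousOn (fun z => (logGamma z).im) slitPlane := fun z hz =>
    (continuous_im.continuousAt.comp (hasDerivAt_logGamma hz).continuousAt).continuousWithinAt
  have e : principalDomain α = {z | α < z.re} ∪
      (({z | 0 < z.im} ∩ (slitPlane ∩ (fun z => (logGamma z).im) ⁻¹' Set.Ioi 0)) ∪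
        ({z | z.im < 0} ∩ (slitPlane ∩ (fun z => (logGamma z).im) ⁻¹' Set.Iio 0))) := by
    ext z
    have := @principalDomain_subset_slitPlane α hα z
    simp only [principalDomain, Set.mem_ofPred_eq, Set.mem_union, Set.mem_inter_iff,
      Set.mem_preimage, Set.mem_Ioi, Set.mem_Iio] at this ⊢
    tauto
  rw [e]
  exact (isOpen_lt continuous_const continuous_re).union
    (((isOpen_lt continuous_const continuous_im).inter
      (hcont.isOpen_inter_preimage isOpen_slitPlane isOpen_Ioi)).union
    ((isOpen_lt continuous_im continuous_const).inter
      (hcont.isOpen_inter_preimage isOpen_slitPlane isOpen_Iio)))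

lemma conj_mem_principalDomain (hα : 0 < α) {z : ℂ} (hz : z ∈ principalDomain α) :
    conj z ∈ principalDomain α := by
  have hs := principalDomain_subset_slitPlane hα hz
  simp only [principalDomain, Set.mem_ofPred_eq, logGamma_conj hs, conj_re, conj_im] at hz ⊢
  rcases hz with h | h | h
  · exact Or.inl h
  · exact Or.inr (Or.inr ⟨neg_lt_zero.2 h.1, neg_lt_zero.2 h.2⟩)
  · exact Or.inr (Or.inl ⟨neg_pos.2 h.1, neg_pos.2 h.2⟩)

/-- On the principal domain, `logGamma` preserves the sign of the imaginary part. -/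
lemma principalDomain_cases (hα : 0 < α) (hψ : (psi α).re = 0) {z : ℂ}
    (hz : z ∈ principalDomain α) :
    (0 < z.im ∧ 0 < (logGamma z).im) ∨ (z.im < 0 ∧ (logGamma z).im < 0) ∨
      (α < z.re ∧ z.im = 0 ∧ (logGamma z).im = 0) := by
  rcases hz with h | h | h
  · have hs : z ∈ slitPlane := mem_slitPlane_iff.2 (Or.inl (hα.trans h))
    rcases lt_trichotomy z.im 0 with h0 | h0 | h0
    · have := logGamma_im_pos hα hψ (z := conj z) (by simpa using h) (by simpa using h0)
      rw [logGamma_conj hs, conj_im] at this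
      exact Or.inr (Or.inl ⟨h0, neg_pos.1 this⟩)
    · refine Or.inr (Or.inr ⟨h, h0, ?_⟩)
      have hzr : z = (z.re : ℂ) := by apply Complex.ext <;> simp [h0]
      rw [hzr, logGamma_im_ofReal (hα.trans h)]
    · exact Or.inl ⟨h0, logGamma_im_pos hα hψ h h0⟩
  · exact Or.inl h
  · exact Or.inr (Or.inl h)

lemma psi_ne_zero (hα : 0 < α) (hψ : (psi α).re = 0) {z : ℂ} (hz : z ∈ principalDomain α) :
    psi z ≠ 0 := by
  intro h0
  rcases hz with h | h | h
  · simpa [h0] using psi_re_pos hα hψ h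
  · simpa [h0] using psi_im_pos h.1
  · simpa [h0] using psi_im_neg h.1

lemma logGamma_injOn_re_gt (hα : 0 < α) (hψ : (psi α).re = 0) :
    Set.InjOn logGamma {z : ℂ | α < z.re} := by
  intro a ha b hb hab
  obtain ⟨ξ, hξ, h⟩ := exists_re_mul_sub_eq (convex_halfSpace_re_gt α)
    (fun z hz => hasDerivAt_logGamma (mem_slitPlane_iff.2 (Or.inl (hα.trans hz)))) 1 ha hb
  have hpos : 0 < (1 * psi ξ).re := by simpa using psi_re_pos hα hψ hξ
  rw [hab, sub_self, mul_zero, zero_mul, zero_re, eq_comm, mul_eq_zero] at h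
  have := h.resolve_left hpos.ne'
  rw [sq_eq_zero_iff, norm_eq_zero, sub_eq_zero] at this
  exact this.symm

lemma logGamma_injOn_principalDomain (hα : 0 < α) (hψ : (psi α).re = 0) :
    Set.InjOn logGamma (principalDomain α) := by
  intro a ha b hb hab
  have has := principalDomain_subset_slitPlane hα ha
  have hbs := principalDomain_subset_slitPlane hα hb
  rcases principalDomain_cases hα hψ ha with h | h | h <;>
  rcases principalDomain_cases hα hψ hb with h' | h' | h' <;>
  rw [hab] at h
  · exact logGamma_injOn_im_pos h.1 h'.1 hab
  · linarith [h.2, h'.2]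
  · linarith [h.2, h'.2.2]
  · linarith [h.2, h'.2]
  · have := logGamma_injOn_im_pos (x₁ := conj a) (x₂ := conj b) (by simpa using h.1)
      (by simpa using h'.1) (by rw [logGamma_conj has, logGamma_conj hbs, hab])
    exact (starRingEnd ℂ).injective this
  · linarith [h.2, h'.2.2]
  · linarith [h.2.2, h'.2]
  · linarith [h.2.2, h'.2]
  · exact logGamma_injOn_re_gt hα hψ h.1 h'.1 hab

lemma log_im_pos {w : ℂ} (hw : 0 < w.im) : 0 < (log w).im := by
  rw [log_im]
  refine lt_of_le_of_ne (arg_nonneg_iff.2 hw.le) fun h => ?_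
  exact hw.ne' (arg_eq_zero_iff.1 h.symm).2

lemma slit_subset_slitPlane (hα : 0 < α) {w : ℂ} (hw : w.im ≠ 0 ∨ Real.Gamma α < w.re) :
    w ∈ slitPlane :=
  mem_slitPlane_iff.2 (hw.symm.imp_left (Real.Gamma_pos_of_pos hα).trans)

lemma exists_ofReal_logGamma_eq_log (hα : 0 < α) {w : ℝ} (hw : Real.Gamma α < w) :
    ∃ x : ℝ, α < x ∧ Real.Gamma x = w ∧ logGamma x = log w := by
  obtain ⟨x, hx, hxw⟩ := exists_Gamma_eq hα hw
  refine ⟨x, hx, hxw, ?_⟩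
  rw [logGamma_ofReal (hα.trans hx), hxw, ofReal_log ((Real.Gamma_pos_of_pos hα).trans hw).le]

lemma log_mem_image (hα : 0 < α) (hψ : (psi α).re = 0) {w : ℂ}
    (hw : w.im ≠ 0 ∨ Real.Gamma α < w.re) : log w ∈ logGamma '' principalDomain α := by
  have upper : ∀ w : ℂ, 0 < w.im → log w ∈ logGamma '' principalDomain α := by
    intro w hw
    obtain ⟨z, hz, hzw⟩ := exists_logGamma_eq hα hψ (log_im_pos hw)
    exact ⟨z, Or.inr (Or.inl ⟨hz, hzw ▸ log_im_pos hw⟩), hzw⟩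
  rcases lt_trichotomy w.im 0 with h | h | h
  · obtain ⟨z, hz, hzw⟩ := upper (conj w) (by simpa using h)
    refine ⟨conj z, conj_mem_principalDomain hα hz, ?_⟩
    rw [logGamma_conj (principalDomain_subset_slitPlane hα hz), hzw,
      log_conj w (slitPlane_arg_ne_pi (slit_subset_slitPlane hα hw)), conj_conj]
  · have hwr : w = (w.re : ℂ) := by apply Complex.ext <;> simp [h]
    obtain ⟨x, hx, -, hxw⟩ := exists_ofReal_logGamma_eq_log hα (hw.resolve_left (not_not.2 h))
    exact ⟨x, Or.inl (by simpa using hx), by rw [hxw, ← hwr]⟩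
  · exact upper w h

lemma differentiableAt_invFunOn_logGamma (hα : 0 < α) (hψ : (psi α).re = 0) {ζ : ℂ}
    (hζ : ζ ∈ logGamma '' principalDomain α) :
    DifferentiableAt ℂ (Function.invFunOn logGamma (principalDomain α)) ζ := by
  obtain ⟨z, hz, rfl⟩ := hζ
  have hd := hasStrictDerivAt_logGamma (principalDomain_subset_slitPlane hα hz)
  have hinv := hd.to_local_left_inverse (psi_ne_zero hα hψ hz)
    (g := Function.invFunOn logGamma (principalDomain α)) ?_
  · exact hinv.hasDerivAt.differentiableAt
  filter_upwards [(isOpen_principalDomain hα).mem_nhds hz] with u hu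
  exact logGamma_injOn_principalDomain hα hψ (Function.invFunOn_mem ⟨u, hu, rfl⟩) hu
    (Function.invFunOn_eq ⟨u, hu, rfl⟩)

end Critical

end GammaInverse

open GammaInverse in
/-- Let `α` be the unique zero of `ψ = Γ'/Γ` on `(0,∞)`.  The inverse of
`Γ` on `(Γ(α),∞)` extends to a holomorphic function `g` on `ℂ ∖ (−∞, Γ(α)]` which is
real-valued and strictly increasing on `(Γ(α),∞)` with image `(α,∞)`, satisfies
`Γ(g(w)) = w`, `g(conj w) = conj (g w)`, and `Im g(z) > 0` for `Im z > 0`; i.e. the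
principal inverse of `Γ` is a Pick function. -/
theorem principal_inverse_gamma_pick (α : ℝ) (hα : 0 < α)
    (hcrit : deriv Real.Gamma α = 0)
    (huniq : ∀ t ∈ Set.Ioi (0 : ℝ), deriv Real.Gamma t = 0 → t = α) :
    ∃ g : ℂ → ℂ,
      DifferentiableOn ℂ g {z : ℂ | z.im ≠ 0 ∨ Real.Gamma α < z.re} ∧
      (∀ x : ℝ, Real.Gamma α < x → (g (x : ℂ)).im = 0) ∧
      StrictMonoOn (fun x : ℝ => (g (x : ℂ)).re) (Set.Ioi (Real.Gamma α)) ∧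
      (fun x : ℝ => (g (x : ℂ)).re) '' Set.Ioi (Real.Gamma α) = Set.Ioi α ∧
      (∀ w : ℂ, (w.im ≠ 0 ∨ Real.Gamma α < w.re) → Complex.Gamma (g w) = w) ∧
      (∀ w : ℂ, (w.im ≠ 0 ∨ Real.Gamma α < w.re) →
        g (starRingEnd ℂ w) = starRingEnd ℂ (g w)) ∧
      (∀ z : ℂ, 0 < z.im → 0 < (g z).im) := by
  have hψ := psi_re_eq_zero_of_deriv_Gamma hα hcrit
  have hinj := logGamma_injOn_principalDomain hα hψ
  have hmono := strictMonoOn_Gamma hα hψ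
  set G : ℂ → ℂ := Function.invFunOn logGamma (principalDomain α)
  have hmem : ∀ w : ℂ, (w.im ≠ 0 ∨ Real.Gamma α < w.re) → G (log w) ∈ principalDomain α :=
    fun w hw => Function.invFunOn_mem (log_mem_image hα hψ hw)
  have heq : ∀ w : ℂ, (w.im ≠ 0 ∨ Real.Gamma α < w.re) → logGamma (G (log w)) = log w :=
    fun w hw => Function.invFunOn_eq (log_mem_image hα hψ hw)
  have hreal : ∀ w : ℝ, Real.Gamma α < w →
      ∃ x : ℝ, α < x ∧ Real.Gamma x = w ∧ G (log w) = x := by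
    intro w hw
    obtain ⟨x, hx, hxw, hlog⟩ := exists_ofReal_logGamma_eq_log hα hw
    have hw' : (w : ℂ).im ≠ 0 ∨ Real.Gamma α < (w : ℂ).re := Or.inr (by simpa using hw)
    exact ⟨x, hx, hxw, hinj (hmem w hw') (Or.inl (by simpa using hx)) ((heq w hw').trans hlog.symm)⟩
  refine ⟨fun w => G (log w), ?_, ?_, ?_, ?_, ?_, ?_, ?_⟩
  · intro w hw
    exact ((differentiableAt_invFunOn_logGamma hα hψ (log_mem_image hα hψ hw)).comp w
      (differentiableAt_log (slit_subset_slitPlane hα hw))).differentiableWithinAt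
  · intro w hw
    obtain ⟨x, -, -, h⟩ := hreal w hw
    simp only [h, ofReal_im]
  · intro u hu v hv huv
    obtain ⟨x, hx, hxu, h⟩ := hreal u hu
    obtain ⟨y, hy, hyv, h'⟩ := hreal v hv
    simp only [h, h', ofReal_re]
    rwa [← hmono.lt_iff_lt hx.le hy.le, hxu, hyv]
  · ext t
    constructor
    · rintro ⟨w, hw, rfl⟩
      obtain ⟨x, hx, -, h⟩ := hreal w hw
      simpa only [h, ofReal_re, Set.mem_Ioi] using hx
    · intro ht
      have hαt : Real.Gamma α < Real.Gamma t := hmono Set.self_mem_Ici (Set.Ioi_subset_Ici_self ht) ht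
      obtain ⟨x, hx, hxu, h⟩ := hreal _ hαt
      refine ⟨Real.Gamma t, hαt, ?_⟩
      simp only [h, ofReal_re]
      exact hmono.injOn hx.le (Set.Ioi_subset_Ici_self ht) hxu
  · intro w hw
    rw [← exp_logGamma (principalDomain_subset_slitPlane hα (hmem w hw)), heq w hw,
      exp_log (slitPlane_ne_zero (slit_subset_slitPlane hα hw))]
  · intro w hw
    have hw' : (starRingEnd ℂ w).im ≠ 0 ∨ Real.Gamma α < (starRingEnd ℂ w).re := by
      simpa using hw
    refine hinj (hmem _ hw') (conj_mem_principalDomain hα (hmem w hw)) ?_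
    rw [heq _ hw', logGamma_conj (principalDomain_subset_slitPlane hα (hmem w hw)), heq w hw,
      log_conj w (slitPlane_arg_ne_pi (slit_subset_slitPlane hα hw))]
  · intro w hw
    have hw' : w.im ≠ 0 ∨ Real.Gamma α < w.re := Or.inl hw.ne'
    have hpos := log_im_pos hw
    rw [← heq w hw'] at hpos
    rcases principalDomain_cases hα hψ (hmem w hw') with h | h | h
    · exact h.1
    · exact absurd hpos h.2.not_gt
    · exact absurd hpos h.2.2.not_gt
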